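/- Let A be a real symmetric N×N matrix such that both A and I − A are positive semidefinite (all eigenvalues of A lie in [0,1]). For α ∈ (0,1), the matrix I − α·A is invertible; define H(α) = (1−α)·(I − α·A)⁻¹. Then for all α_1, α_2 with 0 < α_1 ≤ α_2 < 1 and every vector x̂ ∈ ℝ^N, ‖(H(α_1) − I)·x̂‖ ≤ ‖(H(α_2) − I)·x̂‖, where ‖·‖ is the Euclidean norm. -/

import Mathlib

open Matrix

lemma Matrix.PosSemidef.posDef_one_sub_smul {n : Type*} [Fintype n] [DecidableEq n]
    {A : Matrix n n ℝ} (hA : (1 - A).PosSemidef) {α : ℝ} (h0 : 0 < α) (h1 : α < 1) :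
    (1 - α • A).PosDef := by
  have h : 1 - α • A = (1 - α) • (1 : Matrix n n ℝ) + α • (1 - A) := by
    module
  rw [h]
  exact (Matrix.PosDef.one.smul (sub_pos.2 h1)).add_posSemidef (hA.smul h0.le)

lemma norm_le_norm_of_isPositive_of_smul_eq {E : Type*} [NormedAddCommGroup E]
    [InnerProductSpace ℝ E] [FiniteDimensional ℝ E] {T : E →ₗ[ℝ] E} (hT : T.IsPositive)
    {a b : ℝ} (ha : 0 ≤ a) (hb : 0 < b) {u v : E} (h : a • T (v - u) = b • u) :
    ‖u‖ ≤ ‖v‖ := by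
  have hin : 0 ≤ b * inner ℝ u (v - u) := by
    rw [← real_inner_smul_left, ← h, real_inner_smul_left]
    exact mul_nonneg ha (hT.inner_nonneg_left _)
  have hin' : 0 ≤ inner ℝ u (v - u) := nonneg_of_mul_nonneg_right hin hb
  have hv := norm_add_sq_real u (v - u)
  rw [add_sub_cancel] at hv
  refine le_of_sq_le_sq ?_ (norm_nonneg v)
  nlinarith [sq_nonneg ‖v - u‖]

lemma Matrix.one_sub_smul_mul_resolvent_sub_one {n : Type*} [Fintype n] [DecidableEq n]
    {A : Matrix n n ℝ} {α : ℝ} (h : IsUnit (1 - α • A)) :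
    (1 - α • A) * ((1 - α) • (1 - α • A)⁻¹ - 1) = -(α • (1 - A)) := by
  rw [mul_sub, mul_smul_comm, mul_nonsing_inv _ ((isUnit_iff_isUnit_det _).1 h), mul_one]
  module

lemma Matrix.smul_mul_sub_eq_smul_of_mul_eq {n : Type*} [Fintype n] [DecidableEq n]
    {A B₁ B₂ : Matrix n n ℝ} {α₁ α₂ : ℝ} (h₁ : (1 - α₁ • A) * B₁ = -(α₁ • (1 - A)))
    (h₂ : (1 - α₂ • A) * B₂ = -(α₂ • (1 - A))) :
    α₁ • ((1 - α₂ • A) * (B₂ - B₁)) = (α₂ - α₁) • B₁ := by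
  have h₃ : α₁ • ((1 - α₂ • A) * B₁) = α₂ • ((1 - α₁ • A) * B₁) - (α₂ - α₁) • B₁ := by
    simp only [sub_mul, one_mul, smul_mul_assoc]
    module
  rw [mul_sub, smul_sub, h₃, h₁, h₂]
  module

/-- Bias half of Proposition 3: for `A` symmetric with `0 ⪯ A ⪯ I` and
`H(α) = (1−α)(I − αA)⁻¹`, the bias `‖(H(α) − I) x̂‖` is monotone increasing in `α ∈ (0,1)`. -/
theorem stmt15 (N : ℕ) (A : Matrix (Fin N) (Fin N) ℝ) (hAsymm : A.IsSymm)
    (hA : A.PosSemidef) (hIA : ((1 : Matrix (Fin N) (Fin N) ℝ) - A).PosSemidef) :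
    (∀ α : ℝ, 0 < α → α < 1 → IsUnit (1 - α • A)) ∧
    ∀ α₁ α₂ : ℝ, 0 < α₁ → α₁ ≤ α₂ → α₂ < 1 →
      ∀ xhat : EuclideanSpace ℝ (Fin N),
        ‖Matrix.toEuclideanLin ((1 - α₁) • (1 - α₁ • A)⁻¹ - 1) xhat‖ ≤
          ‖Matrix.toEuclideanLin ((1 - α₂) • (1 - α₂ • A)⁻¹ - 1) xhat‖ := by
  have hunit : ∀ α : ℝ, 0 < α → α < 1 → IsUnit (1 - α • A) := fun α h0 h1 =>
    (hIA.posDef_one_sub_smul h0 h1).isUnit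
  refine ⟨hunit, fun α₁ α₂ h0 h12 h1 x => ?_⟩
  obtain rfl | hlt := h12.eq_or_lt
  · rfl
  have e₁ := one_sub_smul_mul_resolvent_sub_one (hunit α₁ h0 (hlt.trans h1))
  have e₂ := one_sub_smul_mul_resolvent_sub_one (hunit α₂ (h0.trans hlt) h1)
  have hpos := isPositive_toEuclideanLin_iff.2
    (hIA.posDef_one_sub_smul (h0.trans hlt) h1).posSemidef
  have key := smul_mul_sub_eq_smul_of_mul_eq e₁ e₂
  refine norm_le_norm_of_isPositive_of_smul_eq hpos h0.le (sub_pos.2 hlt) ?_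
  rw [← LinearMap.sub_apply, ← map_sub, ← LinearMap.comp_apply, ← toLpLin_mul_same,
    ← LinearMap.smul_apply, ← map_smul, key, map_smul, LinearMap.smul_apply]
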